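/- Let 1 < α ≤ 2, β₁ > 1/(α−1) and 1/α < β₂ < 1. Then the doubly-indexed limit, as n → ∞ and m → ∞ (along the product filter), of ρ(n,−m)/(n^{−β₁} m^{1−β₂α}) exists and equals (Σ_{i=0}^∞ w_{(i,∞)}^{α−1} (1+i)^{−β₁(α−1)}) · ∫₀^∞ v^{−β₂} (1+v)^{−β₂(α−1)} dv. -/

import Mathlib

open Filter MeasureTheory Real Set

/-- The kernel `V(x,y) = xy/(x^2+y^2)^{(2-α)/2}` with `V(0,0)=0`. -/
noncomputable def V (α : ℝ) : ℝ → ℝ → ℝ := fun x y =>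
  if x = 0 ∧ y = 0 then 0 else x * y / (x ^ 2 + y ^ 2) ^ ((2 - α) / 2)

lemma V_form (α x y : ℝ) : V α x y = x * y / (x ^ 2 + y ^ 2) ^ ((2 - α) / 2) := by
  unfold V
  split_ifs with h
  · simp [h.1]
  · rfl

lemma V_scale (α s x y : ℝ) (hs : 0 < s) : V α (s * x) (s * y) = s ^ α * V α x y := by
  rw [V_form, V_form]
  have h1 : (s * x) ^ 2 + (s * y) ^ 2 = s ^ 2 * (x ^ 2 + y ^ 2) := by ring
  have h2 : (s ^ 2 : ℝ) ^ ((2 - α) / 2) = s ^ (2 - α) := by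
    rw [← Real.rpow_natCast, ← Real.rpow_mul hs.le]; congr 1; push_cast; ring
  have h3 : s ^ α * s ^ (2 - α) = s ^ 2 := by
    rw [← Real.rpow_add hs, ← Real.rpow_natCast]; congr 1; push_cast; ring
  rw [h1, Real.mul_rpow (by positivity) (by positivity), h2]
  have h4 : 0 < s ^ (2 - α) := Real.rpow_pos_of_pos hs _
  by_cases h5 : (x ^ 2 + y ^ 2) ^ ((2 - α) / 2) = 0
  · rw [h5]; simp
  · field_simp
    rw [← h3]; ring

lemma V_bound (α a b u A B : ℝ) (hα : 1 < α) (hα2 : α ≤ 2) (ha : |a| ≤ A) (hb : |b| ≤ B) :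
    |a * b / ((u * a) ^ 2 + b ^ 2) ^ ((2 - α) / 2)| ≤ A * B ^ (α - 1) := by
  have hA : 0 ≤ A := (abs_nonneg _).trans ha
  have hB : 0 ≤ B := (abs_nonneg _).trans hb
  by_cases hb0 : b = 0
  · simp [hb0]; positivity
  have hb1 : 0 < |b| := abs_pos.mpr hb0
  have h1 : |b| ^ (2 - α) ≤ ((u * a) ^ 2 + b ^ 2) ^ ((2 - α) / 2) := by
    have : |b| ^ (2 - α) = (b ^ 2) ^ ((2 - α) / 2) := by
      rw [← sq_abs b, ← Real.rpow_natCast, ← Real.rpow_mul hb1.le]; congr 1; push_cast; ring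
    rw [this]
    apply Real.rpow_le_rpow (by positivity) (by nlinarith [sq_nonneg (u * a)]) (by linarith)
  have h2 : 0 < |b| ^ (2 - α) := Real.rpow_pos_of_pos hb1 _
  have h3 : |b| ^ (α - 1) * |b| ^ (2 - α) = |b| := by
    rw [← Real.rpow_add hb1]; ring_nf; simp
  rw [abs_div, abs_mul, abs_of_pos (h2.trans_le h1)]
  calc |a| * |b| / ((u * a) ^ 2 + b ^ 2) ^ ((2 - α) / 2) ≤ |a| * |b| / |b| ^ (2 - α) := by gcongr
    _ = |a| * |b| ^ (α - 1) := by
        rw [div_eq_iff h2.ne', mul_assoc, h3]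
    _ ≤ A * B ^ (α - 1) := by
        gcongr

lemma tsum_eq_int (f : ℕ → ℝ) (m : ℕ) (hm : 1 ≤ m)
    (hf : IntegrableOn (fun t : ℝ => f ⌊(m : ℝ) * t⌋₊) (Ioi 0)) :
    ∑' j, f j = m * ∫ t in Ioi (0 : ℝ), f ⌊(m : ℝ) * t⌋₊ := by
  have hm0 : (0 : ℝ) < m := by exact_mod_cast hm
  rw [integral_comp_mul_left_Ioi (fun t : ℝ => f ⌊t⌋₊) 0 hm0]
  rw [integrableOn_Ioi_comp_mul_left_iff (fun t : ℝ => f ⌊t⌋₊) 0 hm0] at hf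
  rw [mul_zero] at *
  rw [smul_eq_mul, mul_inv_cancel_left₀ hm0.ne', ← integral_Ici_eq_integral_Ioi]
  rw [← integrableOn_Ici_iff_integrableOn_Ioi] at hf
  have hU : (⋃ j : ℕ, Ico (j : ℝ) (j + 1)) = Ici 0 := by
    ext t
    simp only [mem_iUnion, mem_Ico, mem_Ici]
    constructor
    · rintro ⟨j, h, -⟩; exact (Nat.cast_nonneg j).trans h
    · intro h; exact ⟨⌊t⌋₊, Nat.floor_le h, Nat.lt_floor_add_one t⟩
  rw [← hU] at hf ⊢
  have := hasSum_integral_iUnion (s := fun j : ℕ => Ico (j : ℝ) (j + 1))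
    (fun _ => measurableSet_Ico) ?_ hf
  · rw [← this.tsum_eq]
    congr 1; ext j
    rw [setIntegral_congr_fun (g := fun _ => f j) measurableSet_Ico]
    · simp
    · intro t ht
      have : ⌊t⌋₊ = j := (Nat.floor_eq_iff ((Nat.cast_nonneg j).trans ht.1)).2 ht
      simp [this]
  · intro i j hij
    refine Set.disjoint_left.2 fun t h1 h2 => hij ?_
    rw [← (Nat.floor_eq_iff ((Nat.cast_nonneg i).trans h1.1)).2 h1,
      (Nat.floor_eq_iff ((Nat.cast_nonneg j).trans h2.1)).2 h2]

lemma w_bdd (w : ℕ → ℕ → ℝ)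
    (hA1 : Tendsto (fun p : ℕ × ℕ => w p.1 p.2) (atTop ×ˢ atTop) (nhds 1))
    (winf : ℕ → ℝ) (hA2 : ∀ i, Tendsto (fun j => w i j) atTop (nhds (winf i)))
    (wco : ℕ → ℝ) (hA3 : ∀ j, Tendsto (fun i => w i j) atTop (nhds (wco j))) :
    ∃ W : ℝ, 0 < W ∧ ∀ i j, |w i j| ≤ W := by
  have hb : ∀ (f : ℕ → ℝ) (l : ℝ), Tendsto f atTop (nhds l) → ∃ R, 0 ≤ R ∧ ∀ n, |f n| ≤ R := by
    intro f l h
    obtain ⟨R, hR⟩ := (Metric.isBounded_range_of_tendsto f h).exists_norm_le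
    exact ⟨R, (norm_nonneg _).trans (hR _ ⟨0, rfl⟩), fun n => hR _ ⟨n, rfl⟩⟩
  choose R hR0 hR using fun i => hb _ _ (hA2 i)
  choose C hC0 hC using fun i => hb _ _ (hA3 i)
  have h1 : ∀ᶠ p : ℕ × ℕ in atTop ×ˢ atTop, |w p.1 p.2| < 2 :=
    hA1.abs.eventually (gt_mem_nhds (by norm_num))
  rw [prod_atTop_atTop_eq, eventually_atTop] at h1
  obtain ⟨⟨N, M⟩, h1⟩ := h1
  have sR : 0 ≤ ∑ i ∈ Finset.range N, R i := Finset.sum_nonneg fun i _ => hR0 i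
  have sC : 0 ≤ ∑ i ∈ Finset.range M, C i := Finset.sum_nonneg fun i _ => hC0 i
  refine ⟨2 + ∑ i ∈ Finset.range N, R i + ∑ i ∈ Finset.range M, C i, by linarith, fun i j => ?_⟩
  by_cases hi : i < N
  · have := Finset.single_le_sum (fun i _ => hR0 i) (Finset.mem_range.2 hi)
    linarith [hR i j]
  by_cases hj : j < M
  · have := Finset.single_le_sum (fun i _ => hC0 i) (Finset.mem_range.2 hj)
    linarith [hC j i]
  have := h1 (i, j) ⟨not_lt.1 hi, not_lt.1 hj⟩
  simp only at this
  linarith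

lemma g_int (α β : ℝ) (hα : 1 < α) (h1 : 1 < β * α) (h0 : 0 < β) (h2 : β < 1) :
    IntegrableOn (fun v : ℝ => v ^ (-β) * (1 + v) ^ (-(β * (α - 1)))) (Ioi 0) := by
  have hmeas : Measurable (fun v : ℝ => v ^ (-β) * (1 + v) ^ (-(β * (α - 1)))) := by fun_prop
  have hneg : -(β * (α - 1)) ≤ 0 := by nlinarith
  rw [← Ioc_union_Ioi_eq_Ioi (zero_le_one' ℝ)]
  refine IntegrableOn.union ?_ ?_
  · have : IntegrableOn (fun v : ℝ => v ^ (-β)) (Ioc 0 1) := by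
      have := intervalIntegral.intervalIntegrable_rpow' (a := 0) (b := 1) (r := -β) (by linarith)
      rwa [intervalIntegrable_iff_integrableOn_Ioc_of_le zero_le_one] at this
    refine Integrable.mono' this hmeas.aestronglyMeasurable ?_
    refine (ae_restrict_mem measurableSet_Ioc).mono fun v hv => ?_
    have hv0 : 0 < v := hv.1
    rw [Real.norm_of_nonneg (by positivity)]
    refine mul_le_of_le_one_right (by positivity) ?_
    exact Real.rpow_le_one_of_one_le_of_nonpos (by linarith) hneg
  · have := integrableOn_Ioi_rpow_of_lt (a := -(β * α)) (c := 1) (by linarith) one_pos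
    refine Integrable.mono' this hmeas.aestronglyMeasurable ?_
    refine (ae_restrict_mem measurableSet_Ioi).mono fun v hv => ?_
    have hv0 : 0 < v := zero_lt_one.trans hv
    rw [Real.norm_of_nonneg (by positivity)]
    have h3 : v ^ (-(β * α)) = v ^ (-β) * v ^ (-(β * (α - 1))) := by
      rw [← Real.rpow_add hv0]; ring_nf
    rw [h3]
    gcongr ?_ * ?_
    exact Real.rpow_le_rpow_of_nonpos hv0 (by linarith) hneg

noncomputable def Ga (β₁ β₂ : ℝ) (w : ℕ → ℕ → ℝ) (n m i j : ℕ) : ℝ :=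
  w (i + n) j * ((1 + (i : ℝ) + n) / n) ^ (-β₁) * ((1 + (j : ℝ)) / m) ^ (-β₂)

noncomputable def Gb (β₁ β₂ : ℝ) (w : ℕ → ℕ → ℝ) (m i j : ℕ) : ℝ :=
  w i (j + m) * (1 + (i : ℝ)) ^ (-β₁) * ((1 + (j : ℝ) + m) / m) ^ (-β₂)

noncomputable def GG (α β₁ β₂ : ℝ) (w : ℕ → ℕ → ℝ) (n m i j : ℕ) : ℝ :=
  Ga β₁ β₂ w n m i j * Gb β₁ β₂ w m i j /
    (((n : ℝ) ^ (-β₁) * Ga β₁ β₂ w n m i j) ^ 2 + (Gb β₁ β₂ w m i j) ^ 2) ^ ((2 - α) / 2)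

lemma V_eq_GG (α β₁ β₂ : ℝ) (w c : ℕ → ℕ → ℝ)
    (hc : ∀ i j, c i j = w i j * (1 + (i : ℝ)) ^ (-β₁) * (1 + (j : ℝ)) ^ (-β₂))
    (n m i j : ℕ) (hn : 1 ≤ n) (hm : 1 ≤ m) :
    V α (c (i + n) j) (c i (j + m)) =
      (n : ℝ) ^ (-β₁) * (m : ℝ) ^ (-(β₂ * α)) * GG α β₁ β₂ w n m i j := by
  have hn0 : (0 : ℝ) < n := by exact_mod_cast hn
  have hm0 : (0 : ℝ) < m := by exact_mod_cast hm
  have h1 : c (i + n) j = (m : ℝ) ^ (-β₂) * ((n : ℝ) ^ (-β₁) * Ga β₁ β₂ w n m i j) := by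
    rw [hc, Ga, Real.div_rpow (by positivity) hn0.le, Real.div_rpow (by positivity) hm0.le]
    have := Real.rpow_pos_of_pos hn0 (-β₁)
    have := Real.rpow_pos_of_pos hm0 (-β₂)
    push_cast
    rw [← add_assoc]
    field_simp
  have h2 : c i (j + m) = (m : ℝ) ^ (-β₂) * Gb β₁ β₂ w m i j := by
    rw [hc, Gb, Real.div_rpow (by positivity) hm0.le]
    have := Real.rpow_pos_of_pos hm0 (-β₂)
    push_cast
    rw [← add_assoc]
    field_simp
  rw [h1, h2, V_scale _ _ _ _ (Real.rpow_pos_of_pos hm0 _), V_form, GG, ← Real.rpow_mul hm0.le,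
    neg_mul]
  ring

lemma GG_bound (α β₁ β₂ : ℝ) (hα : 1 < α) (hα2 : α ≤ 2) (hβ₁ : 0 < β₁) (hβ₂ : 0 < β₂)
    (w : ℕ → ℕ → ℝ) (W : ℝ) (hW0 : 0 < W) (hW : ∀ i j, |w i j| ≤ W)
    (n m i : ℕ) (hn : 1 ≤ n) (hm : 1 ≤ m) (t : ℝ) (ht : 0 < t) :
    ‖GG α β₁ β₂ w n m i ⌊(m : ℝ) * t⌋₊‖ ≤
      (W * W ^ (α - 1)) * (1 + (i : ℝ)) ^ (-(β₁ * (α - 1))) *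
        (t ^ (-β₂) * (1 + t) ^ (-(β₂ * (α - 1)))) := by
  have hn0 : (0 : ℝ) < n := by exact_mod_cast hn
  have hm0 : (0 : ℝ) < m := by exact_mod_cast hm
  set j := ⌊(m : ℝ) * t⌋₊ with hj
  have hjt : (m : ℝ) * t ≤ 1 + j := by rw [add_comm]; exact (Nat.lt_floor_add_one _).le
  have hja : t ≤ (1 + (j : ℝ)) / m := by rw [le_div_iff₀ hm0]; linarith
  have hjb : 1 + t ≤ (1 + (j : ℝ) + m) / m := by rw [le_div_iff₀ hm0]; linarith
  have hna : 1 ≤ (1 + (i : ℝ) + n) / n := by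
    rw [le_div_iff₀ hn0]; linarith [(Nat.cast_nonneg i : (0 : ℝ) ≤ i)]
  have hA : |Ga β₁ β₂ w n m i j| ≤ W * t ^ (-β₂) := by
    rw [Ga, abs_mul, abs_mul, abs_of_nonneg (a := ((1 + (i : ℝ) + n) / n) ^ (-β₁)) (by positivity),
      abs_of_nonneg (a := ((1 + (j : ℝ)) / m) ^ (-β₂)) (by positivity)]
    have e1 := Real.rpow_le_one_of_one_le_of_nonpos hna (neg_nonpos.2 hβ₁.le)
    have e2 := Real.rpow_le_rpow_of_nonpos ht hja (neg_nonpos.2 hβ₂.le)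
    calc _ ≤ W * 1 * t ^ (-β₂) := by gcongr; exact hW _ _
      _ = _ := by ring
  have hB : |Gb β₁ β₂ w m i j| ≤ W * (1 + (i : ℝ)) ^ (-β₁) * (1 + t) ^ (-β₂) := by
    rw [Gb, abs_mul, abs_mul, abs_of_nonneg (a := (1 + (i : ℝ)) ^ (-β₁)) (by positivity),
      abs_of_nonneg (a := ((1 + (j : ℝ) + m) / m) ^ (-β₂)) (by positivity)]
    have e2 := Real.rpow_le_rpow_of_nonpos (by linarith) hjb (neg_nonpos.2 hβ₂.le)
    gcongr; exact hW _ _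
  have := V_bound α _ _ ((n : ℝ) ^ (-β₁)) _ _ hα hα2 hA hB
  rw [Real.norm_eq_abs, GG]
  refine this.trans (le_of_eq ?_)
  rw [Real.mul_rpow (by positivity) (by positivity), Real.mul_rpow (by positivity) (by positivity),
    ← Real.rpow_mul (by positivity), ← Real.rpow_mul (by positivity), neg_mul, neg_mul]
  ring

lemma GG_lim (α β₁ β₂ : ℝ) (hβ₁ : 0 < β₁)
    (w : ℕ → ℕ → ℝ)
    (hA1 : Tendsto (fun p : ℕ × ℕ => w p.1 p.2) (atTop ×ˢ atTop) (nhds 1))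
    (i : ℕ) (wi : ℝ) (hwi0 : 0 < wi) (hwi : Tendsto (fun j => w i j) atTop (nhds wi))
    (t : ℝ) (ht : 0 < t) :
    Tendsto (fun p : ℕ × ℕ => GG α β₁ β₂ w p.1 p.2 i ⌊(p.2 : ℝ) * t⌋₊) (atTop ×ˢ atTop)
      (nhds (wi ^ (α - 1) * (1 + (i : ℝ)) ^ (-(β₁ * (α - 1))) *
        (t ^ (-β₂) * (1 + t) ^ (-(β₂ * (α - 1)))))) := by
  have hN : Tendsto (fun p : ℕ × ℕ => p.1) (atTop ×ˢ atTop) atTop := tendsto_fst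
  have hM : Tendsto (fun p : ℕ × ℕ => p.2) (atTop ×ˢ atTop) atTop := tendsto_snd
  have hNR : Tendsto (fun n : ℕ => (n : ℝ)) atTop atTop := tendsto_natCast_atTop_atTop
  have hj0 : Tendsto (fun m : ℕ => ⌊(m : ℝ) * t⌋₊) atTop atTop :=
    tendsto_nat_floor_atTop.comp (hNR.atTop_mul_const ht)
  have hjm : Tendsto (fun m : ℕ => (⌊(m : ℝ) * t⌋₊ : ℝ) / m) atTop (nhds t) := by
    have := (tendsto_nat_floor_mul_div_atTop (R := ℝ) ht.le).comp hNR
    refine this.congr fun m => ?_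
    simp [mul_comm]
  have hinv : Tendsto (fun m : ℕ => (1 : ℝ) / m) atTop (nhds 0) := tendsto_one_div_atTop_nhds_zero_nat
  have q1 : Tendsto (fun m : ℕ => (1 + (⌊(m : ℝ) * t⌋₊ : ℝ)) / m) atTop (nhds t) := by
    have := hinv.add hjm
    rw [zero_add] at this
    exact this.congr fun m => by rw [add_div]
  have q2 : Tendsto (fun m : ℕ => (1 + (⌊(m : ℝ) * t⌋₊ : ℝ) + m) / m) atTop (nhds (1 + t)) := by
    have := q1.add (tendsto_const_nhds (x := (1 : ℝ)))
    rw [add_comm] at this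
    refine this.congr' ?_
    filter_upwards [eventually_ge_atTop 1] with m hm
    have hm0 : (m : ℝ) ≠ 0 := by positivity
    field_simp
  have q3 : Tendsto (fun n : ℕ => (1 + (i : ℝ) + n) / n) atTop (nhds 1) := by
    have := (hinv.const_mul (1 + (i : ℝ))).add (tendsto_const_nhds (x := (1 : ℝ)))
    rw [mul_zero, zero_add] at this
    refine this.congr' ?_
    filter_upwards [eventually_ge_atTop 1] with m hm
    have hm0 : (m : ℝ) ≠ 0 := by positivity
    field_simp
  have w1 : Tendsto (fun p : ℕ × ℕ => w (i + p.1) ⌊(p.2 : ℝ) * t⌋₊) (atTop ×ˢ atTop) (nhds 1) :=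
    hA1.comp ((tendsto_atTop_mono (fun p : ℕ × ℕ => Nat.le_add_left p.1 i) hN).prodMk
      (hj0.comp hM))
  have w2 : Tendsto (fun p : ℕ × ℕ => w i (⌊(p.2 : ℝ) * t⌋₊ + p.2)) (atTop ×ˢ atTop) (nhds wi) :=
    hwi.comp (tendsto_atTop_mono (fun p : ℕ × ℕ => Nat.le_add_left p.2 _) hM)
  have la : Tendsto (fun p : ℕ × ℕ => Ga β₁ β₂ w p.1 p.2 i ⌊(p.2 : ℝ) * t⌋₊) (atTop ×ˢ atTop)
      (nhds (t ^ (-β₂))) := by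
    have := (w1.mul ((q3.comp hN).rpow_const (p := -β₁) (Or.inl one_ne_zero))).mul
      ((q1.comp hM).rpow_const (p := -β₂) (Or.inl ht.ne'))
    rw [Real.one_rpow, one_mul, one_mul] at this
    exact this
  have lb : Tendsto (fun p : ℕ × ℕ => Gb β₁ β₂ w p.2 i ⌊(p.2 : ℝ) * t⌋₊) (atTop ×ˢ atTop)
      (nhds (wi * (1 + (i : ℝ)) ^ (-β₁) * (1 + t) ^ (-β₂))) :=
    (w2.mul_const _).mul
      ((q2.comp hM).rpow_const (p := -β₂) (Or.inl (by positivity)))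
  have l0 : Tendsto (fun p : ℕ × ℕ => (p.1 : ℝ) ^ (-β₁)) (atTop ×ˢ atTop) (nhds 0) :=
    (tendsto_rpow_neg_atTop hβ₁).comp (hNR.comp hN)
  set B := wi * (1 + (i : ℝ)) ^ (-β₁) * (1 + t) ^ (-β₂) with hB
  have hB0 : 0 < B := by positivity
  have hden : Tendsto (fun p : ℕ × ℕ => (((p.1 : ℝ) ^ (-β₁) *
      Ga β₁ β₂ w p.1 p.2 i ⌊(p.2 : ℝ) * t⌋₊) ^ 2 + (Gb β₁ β₂ w p.2 i ⌊(p.2 : ℝ) * t⌋₊) ^ 2)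
      ^ ((2 - α) / 2)) (atTop ×ˢ atTop) (nhds (B ^ (2 - α))) := by
    have := (((l0.mul la).pow 2).add (lb.pow 2)).rpow_const (p := (2 - α) / 2)
      (Or.inl (by positivity))
    have e : ((0 * t ^ (-β₂)) ^ 2 + B ^ 2) ^ ((2 - α) / 2) = B ^ (2 - α) := by
      rw [zero_mul, zero_pow two_ne_zero, zero_add, ← Real.rpow_natCast, ← Real.rpow_mul hB0.le]
      congr 1; push_cast; ring
    rwa [e] at this
  have hfin := (la.mul lb).div hden (Real.rpow_pos_of_pos hB0 _).ne'
  have e : t ^ (-β₂) * B / B ^ (2 - α) = wi ^ (α - 1) * (1 + (i : ℝ)) ^ (-(β₁ * (α - 1))) *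
        (t ^ (-β₂) * (1 + t) ^ (-(β₂ * (α - 1)))) := by
    have e1 : B = B ^ (α - 1) * B ^ (2 - α) := by
      rw [← Real.rpow_add hB0]; ring_nf; simp
    have e2 : B ^ (α - 1) = wi ^ (α - 1) * (1 + (i : ℝ)) ^ (-(β₁ * (α - 1))) *
        (1 + t) ^ (-(β₂ * (α - 1))) := by
      rw [hB, Real.mul_rpow (by positivity) (by positivity),
        Real.mul_rpow (by positivity) (by positivity),
        ← Real.rpow_mul (by positivity), ← Real.rpow_mul (by positivity), neg_mul, neg_mul]
    have e3 : t ^ (-β₂) * B / B ^ (2 - α) = t ^ (-β₂) * B ^ (α - 1) := by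
      rw [div_eq_iff (Real.rpow_pos_of_pos hB0 _).ne', mul_assoc, ← e1]
    rw [e3, e2]; ring
  rw [e] at hfin
  exact hfin

theorem stmt7 (α β₁ β₂ : ℝ)
    (hα : 1 < α) (hα2 : α ≤ 2)
    (hβ₁ : 1 / (α - 1) < β₁) (hβ₂l : 1 / α < β₂) (hβ₂u : β₂ < 1)
    (w : ℕ → ℕ → ℝ) (hw : ∀ i j, w i j ≠ 0)
    (hA1 : Tendsto (fun p : ℕ × ℕ => w p.1 p.2) (atTop ×ˢ atTop) (nhds 1))
    (winf : ℕ → ℝ)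
    (hA2 : ∀ i, Tendsto (fun j => w i j) atTop (nhds (winf i)) ∧ 0 < winf i)
    (wco : ℕ → ℝ)
    (hA3 : ∀ j, Tendsto (fun i => w i j) atTop (nhds (wco j)) ∧ 0 < wco j)
    (c : ℕ → ℕ → ℝ)
    (hc : ∀ i j, c i j = w i j * (1 + (i : ℝ)) ^ (-β₁) * (1 + (j : ℝ)) ^ (-β₂))
    (ρ : ℕ → ℕ → ℝ)
    (hsum : ∀ n m : ℕ, 1 ≤ n → 1 ≤ m →
      Summable (fun q : ℕ × ℕ => V α (c (q.1 + n) q.2) (c q.1 (q.2 + m))))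
    (hρ : ∀ n m : ℕ, 1 ≤ n → 1 ≤ m →
      ρ n m = ∑' i : ℕ, ∑' j : ℕ, V α (c (i + n) j) (c i (j + m)))
    :
    Tendsto (fun p : ℕ × ℕ => ρ p.1 p.2 / ((p.1 : ℝ) ^ (-β₁) * (p.2 : ℝ) ^ (1 - β₂ * α)))
      (atTop ×ˢ atTop)
      (nhds ((∑' i : ℕ, winf i ^ (α - 1) * (1 + (i : ℝ)) ^ (-(β₁ * (α - 1)))) *
        ∫ v in Ioi (0 : ℝ), v ^ (-β₂) * (1 + v) ^ (-(β₂ * (α - 1))))) := by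
  have hα1 : 0 < α - 1 := by linarith
  have hβ₁0 : 0 < β₁ := (by positivity : 0 < 1 / (α - 1)).trans hβ₁
  have hβ₂0 : 0 < β₂ := (by positivity : 0 < 1 / α).trans hβ₂l
  have hb1 : 1 < β₁ * (α - 1) := by rwa [div_lt_iff₀ hα1] at hβ₁
  have hb2 : 1 < β₂ * α := by rwa [div_lt_iff₀ (by linarith)] at hβ₂l
  obtain ⟨W, hW0, hW⟩ := w_bdd w hA1 winf (fun i => (hA2 i).1) wco (fun j => (hA3 j).1)
  have hg := g_int α β₂ hα hb2 hβ₂0 hβ₂u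
  have hbd : ∀ i : ℕ, IntegrableOn (fun t : ℝ =>
      (W * W ^ (α - 1)) * (1 + (i : ℝ)) ^ (-(β₁ * (α - 1))) *
        (t ^ (-β₂) * (1 + t) ^ (-(β₂ * (α - 1))))) (Ioi 0) := fun i => hg.const_mul _
  have hmeas : ∀ n m i : ℕ, AEStronglyMeasurable
      (fun t : ℝ => GG α β₁ β₂ w n m i ⌊(m : ℝ) * t⌋₊) (volume.restrict (Ioi 0)) := by
    intro n m i
    have h1 : Measurable (fun j : ℕ => GG α β₁ β₂ w n m i j) := measurable_from_top
    exact (h1.comp (Nat.measurable_floor.comp (measurable_const_mul (m : ℝ)))).aestronglyMeasurable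
  have hbound : ∀ n m i : ℕ, 1 ≤ n → 1 ≤ m → ∀ᵐ t ∂(volume.restrict (Ioi (0 : ℝ))),
      ‖GG α β₁ β₂ w n m i ⌊(m : ℝ) * t⌋₊‖ ≤
      (W * W ^ (α - 1)) * (1 + (i : ℝ)) ^ (-(β₁ * (α - 1))) *
        (t ^ (-β₂) * (1 + t) ^ (-(β₂ * (α - 1)))) := fun n m i hn hm =>
    (ae_restrict_mem measurableSet_Ioi).mono fun t ht =>
      GG_bound α β₁ β₂ hα hα2 hβ₁0 hβ₂0 w W hW0 hW n m i hn hm t ht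
  have hev : ∀ᶠ p : ℕ × ℕ in atTop ×ˢ atTop, 1 ≤ p.1 ∧ 1 ≤ p.2 :=
    (tendsto_fst.eventually (eventually_ge_atTop 1)).and
      (tendsto_snd.eventually (eventually_ge_atTop 1))
  have hsumm : Summable (fun i : ℕ => (1 + (i : ℝ)) ^ (-(β₁ * (α - 1)))) := by
    have := (summable_nat_add_iff 1).2 (Real.summable_nat_rpow.2 (by linarith : -(β₁ * (α - 1)) < -1))
    refine this.congr fun i => ?_
    push_cast; rw [add_comm]
  have main : Tendsto (fun p : ℕ × ℕ => ∑' i : ℕ, ∫ t in Ioi (0 : ℝ),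
      GG α β₁ β₂ w p.1 p.2 i ⌊(p.2 : ℝ) * t⌋₊) (atTop ×ˢ atTop)
      (nhds (∑' i : ℕ, ∫ t in Ioi (0 : ℝ), winf i ^ (α - 1) * (1 + (i : ℝ)) ^ (-(β₁ * (α - 1))) *
        (t ^ (-β₂) * (1 + t) ^ (-(β₂ * (α - 1)))))) := by
    refine tendsto_tsum_of_dominated_convergence
      (bound := fun i : ℕ => ∫ t in Ioi (0 : ℝ),
        (W * W ^ (α - 1)) * (1 + (i : ℝ)) ^ (-(β₁ * (α - 1))) *
        (t ^ (-β₂) * (1 + t) ^ (-(β₂ * (α - 1))))) ?_ ?_ ?_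
    · simp_rw [integral_const_mul]
      exact (hsumm.mul_left _).mul_right _
    · intro i
      refine tendsto_integral_filter_of_dominated_convergence _
        (Eventually.of_forall fun p => hmeas _ _ _)
        (hev.mono fun p hp => hbound p.1 p.2 i hp.1 hp.2) (hbd i) ?_
      exact (ae_restrict_mem measurableSet_Ioi).mono fun t ht =>
        GG_lim α β₁ β₂ hβ₁0 w hA1 i (winf i) (hA2 i).2 (hA2 i).1 t ht
    · exact hev.mono fun p hp i => norm_integral_le_of_norm_le (hbd i) (hbound p.1 p.2 i hp.1 hp.2)
  simp_rw [integral_const_mul] at main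
  rw [tsum_mul_right] at main
  refine main.congr' (hev.mono ?_)
  rintro ⟨n, m⟩ ⟨hn, hm⟩
  simp only at hn hm ⊢
  have hn0 : (0 : ℝ) < n := by exact_mod_cast hn
  have hm0 : (0 : ℝ) < m := by exact_mod_cast hm
  have key : ∀ i, ∑' j : ℕ, V α (c (i + n) j) (c i (j + m)) =
      ((n : ℝ) ^ (-β₁) * (m : ℝ) ^ (1 - β₂ * α)) *
        ∫ t in Ioi (0 : ℝ), GG α β₁ β₂ w n m i ⌊(m : ℝ) * t⌋₊ := by
    intro i
    simp_rw [V_eq_GG α β₁ β₂ w c hc n m i _ hn hm]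
    rw [tsum_mul_left, tsum_eq_int _ m hm
      (Integrable.mono' (hbd i) (hmeas n m i) (hbound n m i hn hm)),
      sub_eq_add_neg, Real.rpow_add hm0, Real.rpow_one]
    ring
  rw [hρ n m hn hm]
  simp_rw [key]
  rw [tsum_mul_left, mul_div_cancel_left₀ _ (by positivity)]
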